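/- Let F = ℝ or ℂ, let M(λ) ∈ F[λ]^{m×(m+n)}_d have full-Sylvester-rank, let k' = ⌈md/n⌉ and t = nk' − md, and let N(λ) ∈ F[λ]^{n×(m+n)}_{k'} be a minimal basis dual to M(λ) with highest-row-degree coefficient matrix N_hr ∈ F^{n×(m+n)}. Define θ_1(M) and θ_2(M) as follows: (a) if k' > 1 and t > 0, θ_1(M) = min{ σ_{(k'−1)(m+n)}(S_{k'−1}(M))/√(k'−1), σ_{(k'+d)m}(S_{k'}(M))/√k', σ_{(k'+1+d)m}(S_{k'+1}(M))/√(k'+1) } and θ_2(M) = min{ σ_{(k'+d)m}(S_{k'}(M))/√k', σ_{(k'+1+d)m}(S_{k'+1}(M))/√(k'+1) }; (b) if k' = 1 and t > 0, θ_1(M) = θ_2(M) = min{ σ_{(d+1)m}(S_1(M)), σ_{(d+2)m}(S_2(M))/√2 }; (c) if t = 0, θ_1(M) = min{ σ_{(k'+d)m}(S_{k'}(M))/√k', σ_{(k'+1+d)m}(S_{k'+1}(M))/√(k'+1) } and θ_2(M) = σ_{(k'+1+d)m}(S_{k'+1}(M))/√(k'+1). Then every M̃(λ) ∈ F[λ]^{m×(m+n)}_d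 with ‖S_1(M) − S_1(M̃)‖_2 < (1/2)·θ_1(M)·σ_n(N_hr)/‖S_1(N)‖_F has full-Sylvester-rank and possesses a dual minimal basis Ñ(λ) ∈ F[λ]^{n×(m+n)}_{k'} satisfying ‖S_1(N) − S_1(Ñ)‖_F / ‖S_1(N)‖_F ≤ (2/θ_2(M))·‖S_1(M) − S_1(M̃)‖_2. In addition, if t = 0, then all the row degrees of Ñ(λ) and of N(λ) are equal to k'. -/

import Mathlib

open Polynomial Matrix

noncomputable section

variable {F : Type*} [Field F]

/-- The rows of a polynomial matrix, viewed as vectors of rational functions. -/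
def ratRow {p q : ℕ} (M : Matrix (Fin p) (Fin q) F[X]) (i : Fin p) :
    Fin q → RatFunc F :=
  fun j => algebraMap F[X] (RatFunc F) (M i j)

/-- The rational vector subspace spanned by the rows of a polynomial matrix. -/
def rowSpan {p q : ℕ} (M : Matrix (Fin p) (Fin q) F[X]) :
    Submodule (RatFunc F) (Fin q → RatFunc F) :=
  Submodule.span (RatFunc F) (Set.range (ratRow M))

/-- The degree of the `i`-th row of a polynomial matrix. -/
def rowDeg {p q : ℕ} (M : Matrix (Fin p) (Fin q) F[X]) (i : Fin p) : ℕ :=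
  Finset.univ.sup fun j => (M i j).natDegree

/-- The rows of `M` form a polynomial basis of the rational subspace `V` whose sum of
row degrees is minimal among all polynomial bases of `V`. -/
def IsMinimalBasisOf {p q : ℕ} (V : Submodule (RatFunc F) (Fin q → RatFunc F))
    (M : Matrix (Fin p) (Fin q) F[X]) : Prop :=
  LinearIndependent (RatFunc F) (ratRow M) ∧ rowSpan M = V ∧
    ∀ M' : Matrix (Fin p) (Fin q) F[X],
      LinearIndependent (RatFunc F) (ratRow M') → rowSpan M' = V →
        ∑ i, rowDeg M i ≤ ∑ i, rowDeg M' i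

/-- A polynomial matrix is a minimal basis if its rows form a minimal basis of the
rational subspace they span. -/
def IsMinimalBasis {p q : ℕ} (M : Matrix (Fin p) (Fin q) F[X]) : Prop :=
  IsMinimalBasisOf (rowSpan M) M

/-- A polynomial matrix viewed as a matrix of rational functions. -/
def ratMat {p q : ℕ} (M : Matrix (Fin p) (Fin q) F[X]) :
    Matrix (Fin p) (Fin q) (RatFunc F) :=
  M.map (algebraMap F[X] (RatFunc F))

/-- The right null-space over `F(λ)` of a polynomial matrix. -/
def rightNullSpace {p q : ℕ} (M : Matrix (Fin p) (Fin q) F[X]) :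
    Submodule (RatFunc F) (Fin q → RatFunc F) :=
  LinearMap.ker (Matrix.mulVecLin (ratMat M))

/-- The `k`-th Sylvester matrix of a polynomial matrix regarded as having degree at
most `e`: the block-Toeplitz matrix with `k` block columns whose `j`-th block column
carries the coefficients `M_0, …, M_e` in block rows `j, …, j+e` and zeros elsewhere. -/
def sylv {p q : ℕ} (e k : ℕ) (M : Matrix (Fin p) (Fin q) F[X]) :
    Matrix (Fin (k + e) × Fin p) (Fin k × Fin q) F :=
  fun r c =>
    if (c.1 : ℕ) ≤ (r.1 : ℕ) ∧ (r.1 : ℕ) ≤ (c.1 : ℕ) + e then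
      (M r.2 c.2).coeff ((r.1 : ℕ) - (c.1 : ℕ))
    else 0

/-- `M`, regarded as a polynomial matrix of degree at most `e`, has
full-Sylvester-rank if every Sylvester matrix `S_k`, `k ≥ 1`, has full rank. -/
def HasFullSylvesterRank {p q : ℕ} (e : ℕ) (M : Matrix (Fin p) (Fin q) F[X]) : Prop :=
  ∀ k : ℕ, 1 ≤ k → (sylv e k M).rank = min ((k + e) * p) (k * q)

/-- The `k`-th coefficient matrix of a polynomial matrix. -/
def coeffMat {p q : ℕ} (k : ℕ) (M : Matrix (Fin p) (Fin q) F[X]) :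
    Matrix (Fin p) (Fin q) F :=
  fun i j => (M i j).coeff k

/-- The highest-row-degree coefficient matrix: its `i`-th row is the coefficient of
`λ^{d_i}` in the `i`-th row of `M`, where `d_i` is the `i`-th row degree. -/
def highRowMat {p q : ℕ} (M : Matrix (Fin p) (Fin q) F[X]) :
    Matrix (Fin p) (Fin q) F :=
  fun i j => (M i j).coeff (rowDeg M i)

/-- The `e`-reversal of a polynomial matrix: `rev_e P(λ) = λ^e P(1/λ)`. -/
def revMat {p q : ℕ} (e : ℕ) (P : Matrix (Fin p) (Fin q) F[X]) :
    Matrix (Fin p) (Fin q) F[X] :=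
  fun i j => (P i j).reflect e


variable {𝕜 : Type*} [RCLike 𝕜]

/-- The spectral norm (largest singular value) of a matrix. -/
def sNorm {a b : Type*} [Fintype a] [Fintype b] [DecidableEq b]
    (A : Matrix a b 𝕜) : ℝ :=
  ‖LinearMap.toContinuousLinearMap (Matrix.toEuclideanLin A)‖

/-- The Frobenius norm of a matrix. -/
def fNorm {a b : Type*} [Fintype a] [Fintype b] (A : Matrix a b 𝕜) : ℝ :=
  Real.sqrt (∑ i, ∑ j, ‖A i j‖ ^ 2)

/-- The `j`-th largest singular value of a matrix (`j = 1, 2, …`), via the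
Courant–Fischer variational characterization. -/
def singVal {a b : Type*} [Fintype a] [Fintype b] [DecidableEq b]
    (A : Matrix a b 𝕜) (j : ℕ) : ℝ :=
  sSup {r : ℝ | ∃ V : Submodule 𝕜 (EuclideanSpace 𝕜 b),
    Module.finrank 𝕜 V = j ∧ ∀ x ∈ V, r * ‖x‖ ≤ ‖Matrix.toEuclideanLin A x‖}


section SylvesterAlgebra

/-- All entries of a polynomial vector have degree less than `k`. -/
def VecDegLT {q : ℕ} (k : ℕ) (v : Fin q → F[X]) : Prop :=
  ∀ j c, k ≤ c → (v j).coeff c = 0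

/-- The vector of the first `k` coefficients of a polynomial vector. -/
def coeffVec {q : ℕ} (k : ℕ) (v : Fin q → F[X]) : Fin k × Fin q → F :=
  fun c => (v c.2).coeff c.1

/-- The polynomial vector with prescribed first `k` coefficients. -/
def polyVec {q k : ℕ} (x : Fin k × Fin q → F) : Fin q → F[X] :=
  fun j => ∑ c : Fin k, C (x (c, j)) * X ^ (c : ℕ)

theorem coeff_polyVec {q k : ℕ} (x : Fin k × Fin q → F) (j : Fin q) (r : ℕ) :
    (polyVec x j).coeff r = if h : r < k then x (⟨r, h⟩, j) else 0 := by
  simp only [polyVec, finsetSum_coeff, coeff_C_mul, coeff_X_pow, mul_ite, mul_one, mul_zero]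
  split_ifs with h
  · rw [Finset.sum_eq_single ⟨r, h⟩]
    · simp
    · intro c _ hc
      rw [if_neg]
      rintro rfl
      exact hc rfl
    · simp
  · apply Finset.sum_eq_zero
    intro c _
    rw [if_neg]
    have := c.2
    omega

theorem vecDegLT_polyVec {q k : ℕ} (x : Fin k × Fin q → F) : VecDegLT k (polyVec x) := by
  intro j c hc
  rw [coeff_polyVec, dif_neg (by omega)]

theorem coeffVec_polyVec {q k : ℕ} (x : Fin k × Fin q → F) : coeffVec k (polyVec x) = x := by
  ext ⟨c, j⟩
  simp [coeffVec, coeff_polyVec]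

theorem polyVec_coeffVec {q k : ℕ} {v : Fin q → F[X]} (hv : VecDegLT k v) :
    polyVec (coeffVec k v) = v := by
  ext j r
  rw [coeff_polyVec]
  split_ifs with h
  · rfl
  · exact (hv j r (by omega)).symm

theorem VecDegLT.mono {q k l : ℕ} (h : k ≤ l) {v : Fin q → F[X]} (hv : VecDegLT k v) :
    VecDegLT l v := fun j c hc => hv j c (h.trans hc)

theorem VecDegLT.add {q k : ℕ} {v w : Fin q → F[X]} (hv : VecDegLT k v) (hw : VecDegLT k w) :
    VecDegLT k (v + w) := fun j c hc => by simp [hv j c hc, hw j c hc]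

theorem VecDegLT.neg {q k : ℕ} {v : Fin q → F[X]} (hv : VecDegLT k v) :
    VecDegLT k (-v) := fun j c hc => by simp [hv j c hc]

theorem vecDegLT_zero_iff {q : ℕ} {v : Fin q → F[X]} : VecDegLT 0 v ↔ v = 0 := by
  constructor
  · intro h
    ext j c
    simpa using h j c (Nat.zero_le _)
  · rintro rfl j c _
    simp

theorem VecDegLT.mulVec {p q e k : ℕ} {M : Matrix (Fin p) (Fin q) F[X]}
    (hM : ∀ i j, (M i j).natDegree ≤ e) {v : Fin q → F[X]} (hv : VecDegLT k v) :
    VecDegLT (k + e) (M *ᵥ v) := by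
  intro i r hr
  simp only [Matrix.mulVec, dotProduct, finsetSum_coeff, coeff_mul]
  refine Finset.sum_eq_zero fun j _ => Finset.sum_eq_zero fun c hc => ?_
  rw [Finset.HasAntidiagonal.mem_antidiagonal] at hc
  rcases le_or_gt k c.2 with h | h
  · rw [hv j _ h, mul_zero]
  · rw [coeff_eq_zero_of_natDegree_lt ((hM i j).trans_lt (by omega)), zero_mul]

theorem sylv_mulVec {p q e k : ℕ} {M : Matrix (Fin p) (Fin q) F[X]}
    (hM : ∀ i j, (M i j).natDegree ≤ e) (x : Fin k × Fin q → F) :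
    sylv e k M *ᵥ x = coeffVec (k + e) (M *ᵥ polyVec x) := by
  ext ⟨r, i⟩
  simp only [coeffVec, Matrix.mulVec, dotProduct, polyVec, finsetSum_coeff, Finset.mul_sum]
  rw [Fintype.sum_prod_type, Finset.sum_comm]
  refine Finset.sum_congr rfl fun j _ => Finset.sum_congr rfl fun c _ => ?_
  rw [mul_left_comm, coeff_C_mul, coeff_mul_X_pow', mul_comm, sylv]
  congr 1
  by_cases h : (c : ℕ) ≤ r
  · by_cases h' : (r : ℕ) ≤ c + e
    · simp [h, h']
    · rw [if_neg (by tauto), if_pos h,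
        coeff_eq_zero_of_natDegree_lt ((hM i j).trans_lt (by omega))]
  · simp [h]

theorem sylv_mulVec_coeffVec {p q e k : ℕ} {M : Matrix (Fin p) (Fin q) F[X]}
    (hM : ∀ i j, (M i j).natDegree ≤ e) {v : Fin q → F[X]} (hv : VecDegLT k v) :
    sylv e k M *ᵥ coeffVec k v = coeffVec (k + e) (M *ᵥ v) := by
  rw [sylv_mulVec hM, polyVec_coeffVec hv]

theorem sylv_mulVec_eq_zero_iff {p q e k : ℕ} {M : Matrix (Fin p) (Fin q) F[X]}
    (hM : ∀ i j, (M i j).natDegree ≤ e) (x : Fin k × Fin q → F) :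
    sylv e k M *ᵥ x = 0 ↔ M *ᵥ polyVec x = 0 := by
  rw [sylv_mulVec hM]
  constructor
  · intro h
    rw [← polyVec_coeffVec ((vecDegLT_polyVec x).mulVec hM), h]
    ext j r
    simp [coeff_polyVec]
  · intro h
    rw [h]
    ext
    simp [coeffVec]

/-- `M` annihilates no nonzero polynomial vector of degree less than `k`. -/
def InjOnDegLT {p q : ℕ} (k : ℕ) (M : Matrix (Fin p) (Fin q) F[X]) : Prop :=
  ∀ v, VecDegLT k v → M *ᵥ v = 0 → v = 0

/-- Every polynomial vector of degree less than `k + e` is the image under `M` of one of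
degree less than `k`. -/
def SurjOnDegLT {p q : ℕ} (e k : ℕ) (M : Matrix (Fin p) (Fin q) F[X]) : Prop :=
  ∀ u, VecDegLT (k + e) u → ∃ v, VecDegLT k v ∧ M *ᵥ v = u

theorem InjOnDegLT.mono {p q k l : ℕ} {M : Matrix (Fin p) (Fin q) F[X]} (h : k ≤ l)
    (hM : InjOnDegLT l M) : InjOnDegLT k M := fun v hv => hM v (hv.mono h)

theorem injOnDegLT_iff {p q e k : ℕ} {M : Matrix (Fin p) (Fin q) F[X]}
    (hM : ∀ i j, (M i j).natDegree ≤ e) :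
    InjOnDegLT k M ↔ ∀ x, sylv e k M *ᵥ x = 0 → x = 0 := by
  constructor
  · intro h x hx
    rw [sylv_mulVec_eq_zero_iff hM] at hx
    rw [← coeffVec_polyVec x, h _ (vecDegLT_polyVec x) hx]
    ext
    simp [coeffVec]
  · intro h v hv hv0
    rw [← polyVec_coeffVec hv] at hv0 ⊢
    rw [h _ ((sylv_mulVec_eq_zero_iff hM _).2 hv0)]
    ext j r
    simp [coeff_polyVec]

theorem surjOnDegLT_iff {p q e k : ℕ} {M : Matrix (Fin p) (Fin q) F[X]}
    (hM : ∀ i j, (M i j).natDegree ≤ e) :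
    SurjOnDegLT e k M ↔ ∀ y, ∃ x, sylv e k M *ᵥ x = y := by
  constructor
  · intro h y
    obtain ⟨v, hv, hvy⟩ := h _ (vecDegLT_polyVec y)
    refine ⟨coeffVec k v, ?_⟩
    rw [sylv_mulVec_coeffVec hM hv, hvy, coeffVec_polyVec]
  · intro h u hu
    obtain ⟨x, hx⟩ := h (coeffVec (k + e) u)
    refine ⟨polyVec x, vecDegLT_polyVec x, ?_⟩
    rw [sylv_mulVec hM] at hx
    rw [← polyVec_coeffVec hu, ← hx, polyVec_coeffVec ((vecDegLT_polyVec x).mulVec hM)]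

theorem rank_eq_card_cols_iff {a b : Type*} [Fintype a] [Fintype b] [DecidableEq b]
    (A : Matrix a b F) : A.rank = Fintype.card b ↔ ∀ x, A *ᵥ x = 0 → x = 0 := by
  have h := LinearMap.finrank_range_add_finrank_ker A.mulVecLin
  rw [Module.finrank_fintype_fun_eq_card] at h
  have h2 : (∀ x, A *ᵥ x = 0 → x = 0) ↔ LinearMap.ker A.mulVecLin = ⊥ := by
    rw [LinearMap.ker_eq_bot']; rfl
  rw [h2, ← Submodule.finrank_eq_zero (R := F), Matrix.rank]
  omega

theorem rank_eq_card_rows_iff {a b : Type*} [Fintype a] [Fintype b] [DecidableEq b]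
    (A : Matrix a b F) : A.rank = Fintype.card a ↔ ∀ y, ∃ x, A *ᵥ x = y := by
  have h2 : (∀ y, ∃ x, A *ᵥ x = y) ↔ LinearMap.range A.mulVecLin = ⊤ := by
    rw [LinearMap.range_eq_top]; rfl
  rw [h2, Matrix.rank, ← Module.finrank_fintype_fun_eq_card F]
  constructor
  · exact Submodule.eq_top_of_finrank_eq
  · intro h
    rw [h, finrank_top]

theorem rank_sylv_eq_cols_iff {p q e k : ℕ} {M : Matrix (Fin p) (Fin q) F[X]}
    (hM : ∀ i j, (M i j).natDegree ≤ e) :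
    (sylv e k M).rank = k * q ↔ InjOnDegLT k M := by
  rw [injOnDegLT_iff hM, ← rank_eq_card_cols_iff]
  simp

theorem rank_sylv_eq_rows_iff {p q e k : ℕ} {M : Matrix (Fin p) (Fin q) F[X]}
    (hM : ∀ i j, (M i j).natDegree ≤ e) :
    (sylv e k M).rank = (k + e) * p ↔ SurjOnDegLT e k M := by
  rw [surjOnDegLT_iff hM, ← rank_eq_card_rows_iff]
  simp

theorem SurjOnDegLT.succ {p q e k : ℕ} {M : Matrix (Fin p) (Fin q) F[X]} (hk : 1 ≤ k)
    (hM : SurjOnDegLT e k M) : SurjOnDegLT e (k + 1) M := by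
  intro u hu
  obtain ⟨v, hv, hvu⟩ := hM (fun i => C ((u i).coeff 0)) (by
    intro i c hc
    rw [coeff_C, if_neg (by omega)])
  obtain ⟨w, hw, hwu⟩ := hM (fun i => (u i).divX) (by
    intro i c hc
    rw [coeff_divX]
    exact hu i _ (by omega))
  refine ⟨v + (X : F[X]) • w, (hv.mono (by omega)).add ?_, ?_⟩
  · intro j c hc
    obtain ⟨c, rfl⟩ : ∃ c', c = c' + 1 := ⟨c - 1, by omega⟩
    simpa using hw j c (by omega)
  · rw [Matrix.mulVec_add, Matrix.mulVec_smul, hvu, hwu]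
    ext1 i
    simp only [Pi.add_apply, Pi.smul_apply, smul_eq_mul]
    rw [add_comm, X_mul_divX_add]

theorem SurjOnDegLT.mono {p q e k l : ℕ} {M : Matrix (Fin p) (Fin q) F[X]} (hk : 1 ≤ k)
    (h : k ≤ l) (hM : SurjOnDegLT e k M) : SurjOnDegLT e l M := by
  induction l, h using Nat.le_induction with
  | base => exact hM
  | succ l hl ih => exact ih.succ (hk.trans hl)

theorem card_le_of_linearIndependent_null {p q e k : ℕ} {M : Matrix (Fin p) (Fin q) F[X]}
    (hM : ∀ i j, (M i j).natDegree ≤ e) {ι : Type*} [Fintype ι] (v : ι → Fin q → F[X])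
    (hv : LinearIndependent F v) (hdeg : ∀ i, VecDegLT k (v i)) (hnull : ∀ i, M *ᵥ v i = 0) :
    Fintype.card ι + (sylv e k M).rank ≤ k * q := by
  have h := LinearMap.finrank_range_add_finrank_ker (sylv e k M).mulVecLin
  rw [Module.finrank_fintype_fun_eq_card] at h
  let x : ι → LinearMap.ker (sylv e k M).mulVecLin := fun i => ⟨coeffVec k (v i), by
    rw [LinearMap.mem_ker, Matrix.mulVecLin_apply, sylv_mulVec_coeffVec hM (hdeg i), hnull i]
    ext
    simp [coeffVec]⟩
  have hx : LinearIndependent F x := by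
    rw [Fintype.linearIndependent_iff] at hv ⊢
    intro g hg
    apply hv g
    have hg' : ∑ i, g i • coeffVec k (v i) = 0 := by
      simpa [x] using congrArg Subtype.val hg
    ext j r
    by_cases hr : r < k
    · have := congrFun hg' (⟨r, hr⟩, j)
      simpa [coeffVec, finsetSum_coeff] using this
    · simp only [Finset.sum_apply, Pi.smul_apply, finsetSum_coeff, coeff_smul]
      refine Finset.sum_eq_zero fun i _ => ?_
      rw [hdeg i j r (by omega), smul_zero]
  have := hx.fintype_card_le_finrank
  rw [Matrix.rank]
  simp only [Fintype.card_prod, Fintype.card_fin] at h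
  omega

theorem exists_linearIndependent_null {p q e k t : ℕ} {M : Matrix (Fin p) (Fin q) F[X]}
    (hM : ∀ i j, (M i j).natDegree ≤ e) (ht : t + (sylv e k M).rank = k * q) :
    ∃ v : Fin t → Fin q → F[X], LinearIndependent F v ∧ (∀ i, VecDegLT k (v i)) ∧
      ∀ i, M *ᵥ v i = 0 := by
  have h := LinearMap.finrank_range_add_finrank_ker (sylv e k M).mulVecLin
  rw [Module.finrank_fintype_fun_eq_card] at h
  simp only [Fintype.card_prod, Fintype.card_fin] at h
  have hker : Module.finrank F (LinearMap.ker (sylv e k M).mulVecLin) = t := by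
    rw [Matrix.rank] at ht
    omega
  let b := Module.finBasisOfFinrankEq _ _ hker
  refine ⟨fun i => polyVec (b i : Fin k × Fin q → F), ?_, fun i => vecDegLT_polyVec _,
    fun i => ?_⟩
  · have hb := b.linearIndependent
    rw [Fintype.linearIndependent_iff] at hb ⊢
    intro g hg
    apply hb g
    ext ⟨c, j⟩
    have := congrArg (fun f => (f j).coeff c) hg
    simpa [coeff_polyVec, finsetSum_coeff] using this
  · rw [← sylv_mulVec_eq_zero_iff hM]
    exact (b i).2

end SylvesterAlgebra

section RationalSpan

/-- A polynomial vector viewed as a vector of rational functions. -/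
def ratVec {q : ℕ} (v : Fin q → F[X]) : Fin q → RatFunc F :=
  fun j => algebraMap F[X] (RatFunc F) (v j)

theorem ratVec_injective {q : ℕ} : Function.Injective (ratVec (F := F) (q := q)) :=
  fun _ _ h => funext fun j => RatFunc.algebraMap_injective F (congrFun h j)

theorem linearIndependent_ratVec_iff {q : ℕ} {ι : Type*} (v : ι → Fin q → F[X]) :
    LinearIndependent (RatFunc F) (fun i => ratVec (v i)) ↔ LinearIndependent F[X] v := by
  rw [← LinearIndependent.iff_fractionRing F[X] (RatFunc F)]
  let f : (Fin q → F[X]) →ₗ[F[X]] (Fin q → RatFunc F) :=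
    (Algebra.linearMap F[X] (RatFunc F)).compLeft (Fin q)
  exact f.linearIndependent_iff (v := v) (LinearMap.ker_eq_bot.2 ratVec_injective)

theorem linearIndependent_ratRow_iff {p q : ℕ} (M : Matrix (Fin p) (Fin q) F[X]) :
    LinearIndependent (RatFunc F) (ratRow M) ↔
      LinearIndependent F[X] (fun i => (M i : Fin q → F[X])) :=
  linearIndependent_ratVec_iff M

theorem ratMat_mulVec_ratVec {p q : ℕ} (M : Matrix (Fin p) (Fin q) F[X]) (v : Fin q → F[X]) :
    ratMat M *ᵥ ratVec v = ratVec (M *ᵥ v) := by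
  ext i
  exact (RingHom.map_mulVec (algebraMap F[X] (RatFunc F)) M v i).symm

theorem ratVec_mem_rightNullSpace {p q : ℕ} (M : Matrix (Fin p) (Fin q) F[X])
    (v : Fin q → F[X]) : ratVec v ∈ rightNullSpace M ↔ M *ᵥ v = 0 := by
  rw [rightNullSpace, LinearMap.mem_ker, Matrix.mulVecLin_apply, ratMat_mulVec_ratVec]
  constructor
  · intro h
    apply ratVec_injective
    rw [h]
    ext
    simp [ratVec]
  · intro h
    rw [h]
    ext
    simp [ratVec]

theorem linearIndependent_polynomial_of_null {p q k : ℕ} {M : Matrix (Fin p) (Fin q) F[X]}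
    (hM : InjOnDegLT k M) {ι : Type*} [Fintype ι] (v : ι → Fin q → F[X])
    (hv : LinearIndependent F v) (hdeg : ∀ i, VecDegLT (k + 1) (v i))
    (hnull : ∀ i, M *ᵥ v i = 0) : LinearIndependent F[X] v := by
  rw [Fintype.linearIndependent_iff] at hv ⊢
  have base : ∀ c : ι → F[X], ∑ i, c i • v i = 0 → ∀ i, (c i).coeff 0 = 0 := by
    intro c hc
    apply hv
    set w : Fin q → F[X] := ∑ i, (c i).coeff 0 • v i with hw
    have hw0 : ∀ j, (w j).coeff 0 = 0 := by
      intro j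
      have := congrArg (fun f => (f j).coeff 0) hc
      simpa [hw, finsetSum_coeff, mul_coeff_zero] using this
    have hwX : w = (X : F[X]) • fun j => (w j).divX := by
      ext1 j
      have := X_mul_divX_add (w j)
      rw [hw0, C_0, add_zero] at this
      exact this.symm
    have hwnull : M *ᵥ w = 0 := by
      have h : w = ∑ i, C ((c i).coeff 0) • v i := by
        rw [hw]
        refine Finset.sum_congr rfl fun i _ => ?_
        ext1 j
        simp [smul_eq_C_mul]
      rw [h, ← Matrix.mulVecLin_apply, map_sum]
      refine Finset.sum_eq_zero fun i _ => ?_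
      rw [map_smul, Matrix.mulVecLin_apply, hnull, smul_zero]
    have hdiv : (fun j => (w j).divX) = 0 := by
      apply hM
      · intro j r hr
        rw [coeff_divX, hw]
        simp only [Finset.sum_apply, Pi.smul_apply, finsetSum_coeff, coeff_smul]
        refine Finset.sum_eq_zero fun i _ => ?_
        rw [hdeg i j (r + 1) (by omega), smul_zero]
      · rw [hwX, Matrix.mulVec_smul] at hwnull
        exact (smul_eq_zero.1 hwnull).resolve_left X_ne_zero
    rw [hwX, hdiv, smul_zero]
  have key : ∀ (r : ℕ) (c : ι → F[X]), ∑ i, c i • v i = 0 → ∀ i, X ^ r ∣ c i := by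
    intro r
    induction r with
    | zero => intro c _ i; simp
    | succ r ih =>
      intro c hc i
      have hX : ∀ i, c i = X * (c i).divX := fun i => by
        have := X_mul_divX_add (c i)
        rw [base c hc i, C_0, add_zero] at this
        exact this.symm
      have hc' : (X : F[X]) • ∑ i, (c i).divX • v i = 0 := by
        rw [Finset.smul_sum, ← hc]
        refine Finset.sum_congr rfl fun i _ => ?_
        rw [smul_smul, ← hX]
      rw [hX i, pow_succ']
      exact mul_dvd_mul_left _ (ih _ ((smul_eq_zero.1 hc').resolve_left X_ne_zero) i)
  intro c hc i
  ext r
  exact X_pow_dvd_iff.1 (key (r + 1) c hc i) r (Nat.lt_succ_self r)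

theorem linearIndependent_of_highCoeff {n q : ℕ} (N : Matrix (Fin n) (Fin q) F[X])
    (δ : Fin n → ℕ) (hdeg : ∀ i, VecDegLT (δ i + 1) (N i))
    (hlead : ∀ a : Fin n → F, (a ᵥ* fun i j => (N i j).coeff (δ i)) = 0 → a = 0) :
    LinearIndependent F[X] (fun i => (N i : Fin q → F[X])) := by
  classical
  rw [Fintype.linearIndependent_iff]
  intro c hc
  by_contra! hne
  obtain ⟨i₁, hi₁⟩ := hne
  obtain ⟨i₀, hi₀, hmax⟩ := Finset.exists_max_image
    (Finset.univ.filter fun i => c i ≠ 0) (fun i => (c i).natDegree + δ i) ⟨i₁, by simpa using hi₁⟩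
  simp only [Finset.mem_filter, Finset.mem_univ, true_and] at hi₀ hmax
  set D := (c i₀).natDegree + δ i₀ with hD
  have ha := hlead (fun i => if δ i ≤ D then (c i).coeff (D - δ i) else 0) (by
    ext j
    have h0 := congrArg (fun f => (f j).coeff D) hc
    simp only [Finset.sum_apply, Pi.smul_apply, smul_eq_mul, finsetSum_coeff, Pi.zero_apply,
      coeff_zero] at h0
    change ∑ i, (if δ i ≤ D then (c i).coeff (D - δ i) else 0) * (N i j).coeff (δ i) = 0
    refine Eq.trans ?_ h0
    refine Finset.sum_congr rfl fun i _ => ?_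
    by_cases hi : c i = 0
    · simp [hi]
    · have h1 := hmax i hi
      have h2 : (N i j).natDegree ≤ δ i :=
        natDegree_le_iff_coeff_eq_zero.2 fun r hr => hdeg i j r hr
      have h3 := coeff_mul_add_eq_of_natDegree_le (df := D - δ i) (dg := δ i)
        (f := c i) (g := N i j) (by omega) h2
      rw [Nat.sub_add_cancel (by omega)] at h3
      rw [h3, if_pos (by omega)])
  have h := congrFun ha i₀
  simp only [hD, Nat.le_add_left, if_true, Nat.add_sub_cancel, Pi.zero_apply] at h
  exact hi₀ (leadingCoeff_eq_zero.1 h)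

theorem finrank_rightNullSpace {p q e k : ℕ} {M : Matrix (Fin p) (Fin q) F[X]} (hk : 1 ≤ k)
    (hM : SurjOnDegLT e k M) :
    p + Module.finrank (RatFunc F) (rightNullSpace M) = q := by
  have h := LinearMap.finrank_range_add_finrank_ker (ratMat M).mulVecLin
  have hr : LinearMap.range (ratMat M).mulVecLin = ⊤ := by
    rw [eq_top_iff, ← (Pi.basisFun (RatFunc F) (Fin p)).span_eq, Submodule.span_le]
    rintro _ ⟨i, rfl⟩
    obtain ⟨v, -, hv⟩ := hM (Pi.single i 1) (by
      intro j c hc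
      by_cases hj : j = i
      · subst hj
        simp [coeff_one, show c ≠ 0 by omega]
      · simp [hj])
    refine ⟨ratVec v, ?_⟩
    rw [Matrix.mulVecLin_apply, ratMat_mulVec_ratVec, hv, Pi.basisFun_apply]
    ext j
    by_cases hj : j = i
    · subst hj
      simp [ratVec]
    · simp [ratVec, hj]
  rw [hr, finrank_top] at h
  rwa [Module.finrank_fintype_fun_eq_card, Module.finrank_fintype_fun_eq_card,
    Fintype.card_fin, Fintype.card_fin] at h

theorem rowSpan_eq_rightNullSpace {p n e k : ℕ} {M : Matrix (Fin p) (Fin (p + n)) F[X]}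
    (hk : 1 ≤ k) (hM : SurjOnDegLT e k M) {N : Matrix (Fin n) (Fin (p + n)) F[X]}
    (hN : LinearIndependent (RatFunc F) (ratRow N)) (hnull : ∀ i, M *ᵥ N i = 0) :
    rowSpan N = rightNullSpace M := by
  have h := finrank_rightNullSpace hk hM
  apply Submodule.eq_of_le_of_finrank_eq
  · rw [rowSpan, Submodule.span_le]
    rintro _ ⟨i, rfl⟩
    exact (ratVec_mem_rightNullSpace M (N i)).2 (hnull i)
  · rw [rowSpan, finrank_span_eq_card hN, Fintype.card_fin]
    omega

theorem vecDegLT_row {p q : ℕ} (N : Matrix (Fin p) (Fin q) F[X]) (i : Fin p) :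
    VecDegLT (rowDeg N i + 1) (N i) := by
  intro j c hc
  refine coeff_eq_zero_of_natDegree_lt (lt_of_le_of_lt ?_ hc)
  exact Finset.le_sup (f := fun j => (N i j).natDegree) (Finset.mem_univ j)

theorem rowDeg_le_iff {p q k : ℕ} (N : Matrix (Fin p) (Fin q) F[X]) (i : Fin p) :
    rowDeg N i ≤ k ↔ VecDegLT (k + 1) (N i) := by
  constructor
  · intro h
    exact (vecDegLT_row N i).mono (by omega)
  · intro h
    exact Finset.sup_le fun j _ => natDegree_le_iff_coeff_eq_zero.2 fun r hr => h j r hr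

theorem le_rowDeg_of_null {m p q k : ℕ} {M : Matrix (Fin m) (Fin q) F[X]}
    (hM : InjOnDegLT k M) {N : Matrix (Fin p) (Fin q) F[X]}
    (hN : LinearIndependent F[X] (fun i => (N i : Fin q → F[X])))
    (hnull : ∀ i, M *ᵥ N i = 0) (i : Fin p) : k ≤ rowDeg N i := by
  by_contra! h
  exact hN.ne_zero i (hM _ ((vecDegLT_row N i).mono h) (hnull i))

theorem le_sum_rowDeg_of_null {m n q e k t : ℕ} {M : Matrix (Fin m) (Fin q) F[X]}
    (hdeg : ∀ i j, (M i j).natDegree ≤ e) (hinj : InjOnDegLT (k - 1) M)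
    (ht : t + (sylv e k M).rank = k * q) {N : Matrix (Fin n) (Fin q) F[X]}
    (hN : LinearIndependent F[X] (fun i => (N i : Fin q → F[X])))
    (hnull : ∀ i, M *ᵥ N i = 0) : n * k ≤ ∑ i, rowDeg N i + t := by
  classical
  have hF : LinearIndependent F (fun i => (N i : Fin q → F[X])) :=
    hN.restrict_scalars (fun a b h => by simpa [smul_eq_C_mul] using h)
  have hcard := card_le_of_linearIndependent_null (k := k) hdeg
    (fun i : {i : Fin n // rowDeg N i < k} => (N i : Fin q → F[X]))
    (hF.comp _ Subtype.val_injective)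
    (fun i => (vecDegLT_row N i).mono i.2) (fun i => hnull i)
  rw [Fintype.card_subtype] at hcard
  have h1 : ∀ i, k ≤ rowDeg N i + if rowDeg N i < k then 1 else 0 := by
    intro i
    have := le_rowDeg_of_null hinj hN hnull i
    split_ifs <;> omega
  have h2 := Finset.sum_le_sum fun i (_ : i ∈ Finset.univ) => h1 i
  rw [Finset.sum_add_distrib, Finset.sum_boole] at h2
  simp only [Finset.sum_const, Finset.card_univ, Fintype.card_fin, smul_eq_mul,
    Nat.cast_id] at h2
  omega

theorem sum_rowDeg_le_of_isMinimalBasis {m n e k t : ℕ}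
    {M : Matrix (Fin m) (Fin (m + n)) F[X]} (hdeg : ∀ i j, (M i j).natDegree ≤ e)
    (hk : 1 ≤ k) (hinj : InjOnDegLT (k - 1) M) (hsurj : SurjOnDegLT e k M)
    (ht : t + (sylv e k M).rank = k * (m + n)) {N : Matrix (Fin n) (Fin (m + n)) F[X]}
    (hN : IsMinimalBasis N) (hnull : ∀ i, M *ᵥ N i = 0)
    (hNdeg : ∀ i, VecDegLT (k + 1) (N i)) : ∑ i, rowDeg N i + t ≤ n * k := by
  classical
  obtain ⟨v, hv, hvdeg, hvnull⟩ := exists_linearIndependent_null hdeg ht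
  have hv' : LinearIndependent (RatFunc F) (fun i => ratVec (v i)) :=
    (linearIndependent_ratVec_iff v).2 (linearIndependent_polynomial_of_null hinj v hv
      (fun i => (hvdeg i).mono (by omega)) hvnull)
  obtain ⟨hNli, -, hNmin⟩ := hN
  obtain ⟨b, hbT, hsb, hTb, hb⟩ := exists_linearIndepOn_id_extension hv'.linearIndepOn_id
    (Set.subset_union_left (s := Set.range fun i => ratVec (v i)) (t := Set.range (ratRow N)))
  have hspan : Submodule.span (RatFunc F) b = rowSpan N := by
    apply le_antisymm
    · rw [Submodule.span_le]
      refine hbT.trans (Set.union_subset ?_ Submodule.subset_span)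
      rintro _ ⟨i, rfl⟩
      rw [rowSpan_eq_rightNullSpace hk hsurj hNli hnull]
      exact (ratVec_mem_rightNullSpace M (v i)).2 (hvnull i)
    · exact Submodule.span_le.2 (Set.subset_union_right.trans hTb)
  have hbli : LinearIndependent (RatFunc F) ((↑) : b → Fin (m + n) → RatFunc F) := hb
  have hbfin : b.Finite := hbli.setFinite
  have := hbfin.fintype
  have hbcard : Fintype.card b = n := by
    have h1 := finrank_span_eq_card hbli
    have h2 := finrank_span_eq_card hNli
    rw [Subtype.range_coe, hspan] at h1
    rw [← h1, rowSpan, h2, Fintype.card_fin]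
  let f : Fin n ≃ b := (Fintype.equivFinOfCardEq hbcard).symm
  have hrep : ∀ x : b, ∃ w : Fin (m + n) → F[X], ratVec w = x ∧ VecDegLT (k + 1) w ∧
      ((x : Fin (m + n) → RatFunc F) ∈ Set.range (fun i => ratVec (v i)) → VecDegLT k w) := by
    intro x
    by_cases hx : (x : Fin (m + n) → RatFunc F) ∈ Set.range (fun i => ratVec (v i))
    · obtain ⟨i, hi⟩ := hx
      exact ⟨v i, hi, (hvdeg i).mono (by omega), fun _ => hvdeg i⟩
    · obtain ⟨i, hi⟩ := (hbT x.2).resolve_left hx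
      exact ⟨N i, hi, hNdeg i, fun h => absurd h hx⟩
  choose w hw hwdeg hwlow using hrep
  let N' : Matrix (Fin n) (Fin (m + n)) F[X] := fun i => w (f i)
  have hrow : ratRow N' = ((↑) : b → Fin (m + n) → RatFunc F) ∘ f := by
    ext1 i
    exact hw (f i)
  have hmin := hNmin N' (by rw [hrow]; exact hbli.comp _ f.injective) (by
    rw [rowSpan, hrow, f.surjective.range_comp, Subtype.range_coe, hspan])
  have hlow : t ≤ (Finset.univ.filter fun i =>
      (f i : Fin (m + n) → RatFunc F) ∈ Set.range (fun i => ratVec (v i))).card := by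
    have hinjv : Function.Injective fun i => f.symm ⟨ratVec (v i), hsb ⟨i, rfl⟩⟩ := by
      intro i j hij
      exact hv'.injective (congrArg Subtype.val (f.symm.injective hij))
    calc t = (Finset.univ.image fun i => f.symm ⟨ratVec (v i), hsb ⟨i, rfl⟩⟩).card := by
          rw [Finset.card_image_of_injective _ hinjv, Finset.card_univ, Fintype.card_fin]
      _ ≤ _ := Finset.card_le_card fun i hi => by
          obtain ⟨j, -, rfl⟩ := Finset.mem_image.1 hi
          simp
  have h1 : ∀ i, (rowDeg N' i + if (f i : Fin (m + n) → RatFunc F) ∈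
      Set.range (fun i => ratVec (v i)) then 1 else 0) ≤ k := by
    intro i
    split_ifs with h
    · have := (rowDeg_le_iff (k := k - 1) N' i).2 ((hwlow (f i) h).mono (by omega))
      omega
    · exact (rowDeg_le_iff N' i).2 (hwdeg (f i))
  have h2 := Finset.sum_le_sum fun i (_ : i ∈ Finset.univ) => h1 i
  rw [Finset.sum_add_distrib, Finset.sum_boole] at h2
  simp only [Finset.sum_const, Finset.card_univ, Fintype.card_fin, smul_eq_mul,
    Nat.cast_id] at h2
  omega

end RationalSpan

section NormEstimates

theorem toEuclideanLin_ofLp {a b : Type*} [Fintype b] [DecidableEq b]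
    (A : Matrix a b 𝕜) (x : EuclideanSpace 𝕜 b) :
    (Matrix.toEuclideanLin A x).ofLp = A *ᵥ x.ofLp := rfl

theorem fNorm_nonneg {a b : Type*} [Fintype a] [Fintype b] (A : Matrix a b 𝕜) :
    0 ≤ fNorm A := Real.sqrt_nonneg _

theorem fNorm_sq {a b : Type*} [Fintype a] [Fintype b] (A : Matrix a b 𝕜) :
    fNorm A ^ 2 = ∑ i, ∑ j, ‖A i j‖ ^ 2 :=
  Real.sq_sqrt (by positivity)

variable {a b : Type*} [Fintype a] [Fintype b] [DecidableEq b]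

theorem sNorm_nonneg (A : Matrix a b 𝕜) : 0 ≤ sNorm A := norm_nonneg _

theorem norm_toEuclideanLin_le_sNorm (A : Matrix a b 𝕜) (x : EuclideanSpace 𝕜 b) :
    ‖Matrix.toEuclideanLin A x‖ ≤ sNorm A * ‖x‖ :=
  (LinearMap.toContinuousLinearMap (Matrix.toEuclideanLin A)).le_opNorm x

theorem norm_toEuclideanLin_le_fNorm (A : Matrix a b 𝕜) (x : EuclideanSpace 𝕜 b) :
    ‖Matrix.toEuclideanLin A x‖ ≤ fNorm A * ‖x‖ := by
  refine le_of_sq_le_sq ?_ (mul_nonneg (fNorm_nonneg A) (norm_nonneg x))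
  rw [mul_pow, fNorm_sq, EuclideanSpace.norm_sq_eq, EuclideanSpace.norm_sq_eq, Finset.sum_mul]
  refine Finset.sum_le_sum fun i _ => ?_
  refine le_trans ?_ (Finset.sum_mul_sq_le_sq_mul_sq _ _ _)
  gcongr
  rw [toEuclideanLin_ofLp, Matrix.mulVec, dotProduct]
  refine (norm_sum_le _ _).trans_eq ?_
  simp_rw [norm_mul]

theorem singVal_nonneg (A : Matrix a b 𝕜) (j : ℕ) : 0 ≤ singVal A j := by
  rw [singVal]
  set S := {r : ℝ | ∃ V : Submodule 𝕜 (EuclideanSpace 𝕜 b),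
    Module.finrank 𝕜 V = j ∧ ∀ x ∈ V, r * ‖x‖ ≤ ‖Matrix.toEuclideanLin A x‖}
  by_cases hS : BddAbove S
  · rcases S.eq_empty_or_nonempty with h | ⟨r, V, hV, -⟩
    · rw [h, Real.sSup_empty]
    · exact le_csSup hS ⟨V, hV, fun x _ => by simp⟩
  · rw [Real.sSup_of_not_bddAbove hS]

theorem exists_subspace_of_lt_singVal {A : Matrix a b 𝕜} {j : ℕ} {r : ℝ} (hr : 0 ≤ r)
    (h : r < singVal A j) : ∃ V : Submodule 𝕜 (EuclideanSpace 𝕜 b),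
      Module.finrank 𝕜 V = j ∧ ∀ x ∈ V, r * ‖x‖ ≤ ‖Matrix.toEuclideanLin A x‖ := by
  rw [singVal] at h
  have hne : {r : ℝ | ∃ V : Submodule 𝕜 (EuclideanSpace 𝕜 b),
      Module.finrank 𝕜 V = j ∧ ∀ x ∈ V, r * ‖x‖ ≤ ‖Matrix.toEuclideanLin A x‖}.Nonempty := by
    by_contra hne
    rw [Set.not_nonempty_iff_eq_empty] at hne
    rw [hne, Real.sSup_empty] at h
    exact absurd h (not_lt.2 hr)
  obtain ⟨r', ⟨V, hV, hVr⟩, hrr'⟩ := exists_lt_of_lt_csSup hne h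
  exact ⟨V, hV, fun x hx => le_trans (by gcongr) (hVr x hx)⟩

theorem singVal_le_fNorm (A : Matrix a b 𝕜) {j : ℕ} (hj : 0 < j) : singVal A j ≤ fNorm A := by
  by_contra! h
  obtain ⟨r, hr1, hr2⟩ := exists_between h
  obtain ⟨V, hV, hVr⟩ := exists_subspace_of_lt_singVal ((fNorm_nonneg A).trans hr1.le) hr2
  have hV' : V ≠ ⊥ := by
    rintro rfl
    simp at hV
    omega
  obtain ⟨x, hx, hx0⟩ := V.exists_mem_ne_zero_of_ne_bot hV'
  have h1 := (hVr x hx).trans (norm_toEuclideanLin_le_fNorm A x)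
  have h2 := norm_pos_iff.2 hx0
  exact absurd (le_of_mul_le_mul_right h1 h2) (not_le.2 hr1)

theorem exists_subspace_of_perturbation {A B : Matrix a b 𝕜} {j : ℕ} {ε r : ℝ} (hr : 0 ≤ r)
    (hAB : ∀ x, ‖Matrix.toEuclideanLin (A - B) x‖ ≤ ε * ‖x‖) (h : r < singVal A j) :
    ∃ V : Submodule 𝕜 (EuclideanSpace 𝕜 b),
      Module.finrank 𝕜 V = j ∧ ∀ x ∈ V, (r - ε) * ‖x‖ ≤ ‖Matrix.toEuclideanLin B x‖ := by
  obtain ⟨V, hV, hVr⟩ := exists_subspace_of_lt_singVal hr h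
  refine ⟨V, hV, fun x hx => ?_⟩
  have h1 := hVr x hx
  have h2 := hAB x
  rw [map_sub, LinearMap.sub_apply] at h2
  have h3 := norm_sub_norm_le (Matrix.toEuclideanLin A x) (Matrix.toEuclideanLin B x)
  linarith

theorem exists_preimage_of_perturbation {A B : Matrix a b 𝕜} {j : ℕ} {ε r : ℝ}
    (hj : Fintype.card a = j) (hr : 0 ≤ r) (hεr : ε < r)
    (hAB : ∀ x, ‖Matrix.toEuclideanLin (A - B) x‖ ≤ ε * ‖x‖) (h : r < singVal A j)
    (y : EuclideanSpace 𝕜 a) :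
    ∃ x, Matrix.toEuclideanLin B x = y ∧ (r - ε) * ‖x‖ ≤ ‖y‖ := by
  obtain ⟨V, hV, hVr⟩ := exists_subspace_of_perturbation hr hAB h
  have hinj : Function.Injective ((Matrix.toEuclideanLin B).domRestrict V) := by
    rw [← LinearMap.ker_eq_bot, LinearMap.ker_eq_bot']
    intro x hx
    have h1 := hVr x x.2
    rw [LinearMap.domRestrict_apply] at hx
    rw [hx, norm_zero] at h1
    have h2 : ‖(x : EuclideanSpace 𝕜 b)‖ ≤ 0 := by
      by_contra! h3
      exact absurd h1 (not_le.2 (mul_pos (sub_pos.2 hεr) h3))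
    exact Subtype.ext (norm_le_zero_iff.1 h2)
  have hsurj := (LinearMap.injective_iff_surjective_of_finrank_eq_finrank
    (by rw [hV, finrank_euclideanSpace, hj])).1 hinj
  obtain ⟨x, hx⟩ := hsurj y
  refine ⟨x, hx, ?_⟩
  rw [← hx]
  exact hVr x x.2

theorem injective_of_perturbation {A B : Matrix a b 𝕜} {j : ℕ} {ε : ℝ}
    (hj : Fintype.card b = j) (hε : 0 ≤ ε)
    (hAB : ∀ x, ‖Matrix.toEuclideanLin (A - B) x‖ ≤ ε * ‖x‖) (h : ε < singVal A j)
    (x : b → 𝕜) (hx : B *ᵥ x = 0) : x = 0 := by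
  obtain ⟨r, hr1, hr2⟩ := exists_between h
  obtain ⟨V, hV, hVr⟩ := exists_subspace_of_perturbation (hε.trans hr1.le) hAB hr2
  have htop : V = ⊤ := Submodule.eq_top_of_finrank_eq (by rw [hV, finrank_euclideanSpace, hj])
  have h1 := hVr (WithLp.toLp 2 x) (by rw [htop]; trivial)
  have h2 : Matrix.toEuclideanLin B (WithLp.toLp 2 x) = 0 := by
    apply WithLp.ofLp_injective
    rw [toEuclideanLin_ofLp]
    exact hx
  rw [h2, norm_zero] at h1
  have h3 : ‖(WithLp.toLp 2 x : EuclideanSpace 𝕜 b)‖ ≤ 0 := by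
    by_contra! h3
    exact absurd h1 (not_le.2 (mul_pos (sub_pos.2 hr1) h3))
  exact congrArg WithLp.ofLp (norm_le_zero_iff.1 h3)

theorem sylv_sub {p q e k : ℕ} (M M' : Matrix (Fin p) (Fin q) F[X]) :
    sylv e k (M - M') = sylv e k M - sylv e k M' := by
  ext r c
  simp only [sylv, Matrix.sub_apply, coeff_sub]
  split_ifs <;> simp

theorem norm_sylv_le {p q e k : ℕ} (M : Matrix (Fin p) (Fin q) 𝕜[X])
    (x : EuclideanSpace 𝕜 (Fin k × Fin q)) :
    ‖Matrix.toEuclideanLin (sylv e k M) x‖ ≤ Real.sqrt k * sNorm (sylv e 1 M) * ‖x‖ := by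
  let xc : Fin k → EuclideanSpace 𝕜 (Fin 1 × Fin q) :=
    fun c => WithLp.toLp 2 fun z => x.ofLp (c, z.2)
  let T : Fin k → EuclideanSpace 𝕜 (Fin (1 + e) × Fin p) →
      EuclideanSpace 𝕜 (Fin (k + e) × Fin p) := fun c y => WithLp.toLp 2 fun r =>
    if h : (c : ℕ) ≤ (r.1 : ℕ) ∧ (r.1 : ℕ) ≤ (c : ℕ) + e then
      y.ofLp (⟨(r.1 : ℕ) - c, by omega⟩, r.2) else 0
  have hT : ∀ c y, ‖T c y‖ = ‖y‖ := by
    intro c y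
    rw [EuclideanSpace.norm_eq, EuclideanSpace.norm_eq]
    congr 1
    refine (Fintype.sum_of_injective
      (fun z : Fin (1 + e) × Fin p => ((⟨(c : ℕ) + z.1, by omega⟩ : Fin (k + e)), z.2))
      ?_ _ _ ?_ ?_).symm
    · rintro ⟨z, i⟩ ⟨z', i'⟩ h
      simp only [Prod.mk.injEq, Fin.mk.injEq] at h
      ext
      · simp; omega
      · simp [h.2]
    · rintro ⟨r, i⟩ hr
      have : ¬ ((c : ℕ) ≤ (r : ℕ) ∧ (r : ℕ) ≤ (c : ℕ) + e) := by
        intro h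
        apply hr
        refine ⟨(⟨(r : ℕ) - c, by omega⟩, i), ?_⟩
        ext
        · simp; omega
        · rfl
      simp [T, this]
    · rintro ⟨z, i⟩
      have : (z : ℕ) ≤ e := by omega
      simp [T, this]
  have hsum : Matrix.toEuclideanLin (sylv e k M) x =
      ∑ c, T c (Matrix.toEuclideanLin (sylv e 1 M) (xc c)) := by
    apply WithLp.ofLp_injective
    ext ⟨r, i⟩
    rw [toEuclideanLin_ofLp, WithLp.ofLp_sum, Finset.sum_apply, Matrix.mulVec, dotProduct,
      Fintype.sum_prod_type]
    refine Finset.sum_congr rfl fun c _ => ?_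
    by_cases h : (c : ℕ) ≤ (r : ℕ) ∧ (r : ℕ) ≤ (c : ℕ) + e
    · have h' : (r : ℕ) - c ≤ e := by omega
      simp [T, xc, h, h', sylv, Matrix.mulVec, dotProduct, Fintype.sum_prod_type]
    · simp [T, h, sylv]
  have hx : ‖x‖ ^ 2 = ∑ c, ‖xc c‖ ^ 2 := by
    rw [EuclideanSpace.norm_sq_eq, Fintype.sum_prod_type]
    refine Finset.sum_congr rfl fun c _ => ?_
    rw [EuclideanSpace.norm_sq_eq, Fintype.sum_prod_type]
    simp [xc]
  have hcs : ∑ c, ‖xc c‖ ≤ Real.sqrt k * ‖x‖ := by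
    refine le_of_sq_le_sq ?_ (by positivity)
    rw [mul_pow, Real.sq_sqrt (by positivity), hx]
    simpa using sq_sum_le_card_mul_sum_sq (s := Finset.univ) (f := fun c => ‖xc c‖)
  calc ‖Matrix.toEuclideanLin (sylv e k M) x‖
      ≤ ∑ c, ‖T c (Matrix.toEuclideanLin (sylv e 1 M) (xc c))‖ := by
        rw [hsum]
        exact norm_sum_le _ _
    _ ≤ ∑ c, sNorm (sylv e 1 M) * ‖xc c‖ := by
        refine Finset.sum_le_sum fun c _ => ?_
        rw [hT]
        exact norm_toEuclideanLin_le_sNorm _ _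
    _ = sNorm (sylv e 1 M) * ∑ c, ‖xc c‖ := by rw [Finset.mul_sum]
    _ ≤ sNorm (sylv e 1 M) * (Real.sqrt k * ‖x‖) := by
        gcongr
        exact sNorm_nonneg _
    _ = _ := by ring

/-- The sum of squares of the first `k` coefficients of a polynomial vector. -/
def coeffNormSq {q : ℕ} (k : ℕ) (v : Fin q → 𝕜[X]) : ℝ :=
  ∑ c ∈ Finset.range k, ∑ j, ‖(v j).coeff c‖ ^ 2

theorem norm_toLp_coeffVec_sq {q : ℕ} (k : ℕ) (v : Fin q → 𝕜[X]) :
    ‖(WithLp.toLp 2 (coeffVec k v) : EuclideanSpace 𝕜 (Fin k × Fin q))‖ ^ 2 =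
      coeffNormSq k v := by
  rw [EuclideanSpace.norm_sq_eq, Fintype.sum_prod_type, coeffNormSq, ← Fin.sum_univ_eq_sum_range
    (fun c => ∑ j, ‖(v j).coeff c‖ ^ 2)]
  rfl

theorem VecDegLT.coeffNormSq_eq {q k l : ℕ} {v : Fin q → 𝕜[X]} (hv : VecDegLT k v)
    (h : k ≤ l) : coeffNormSq l v = coeffNormSq k v := by
  refine (Finset.sum_subset (Finset.range_mono h) fun c _ hc => ?_).symm
  simp only [Finset.mem_range, not_lt] at hc
  exact Finset.sum_eq_zero fun j _ => by simp [hv j c hc]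

theorem fNorm_sylv_one_sq {p q e : ℕ} (N : Matrix (Fin p) (Fin q) 𝕜[X]) :
    fNorm (sylv e 1 N) ^ 2 = ∑ i, coeffNormSq (1 + e) (N i) := by
  simp only [fNorm_sq, Fintype.sum_prod_type, coeffNormSq]
  rw [Finset.sum_comm]
  refine Finset.sum_congr rfl fun i _ => ?_
  rw [← Fin.sum_univ_eq_sum_range (fun c => ∑ j, ‖(N i j).coeff c‖ ^ 2)]
  refine Finset.sum_congr rfl fun r _ => ?_
  have : (r : ℕ) ≤ e := by omega
  simp [sylv, this]

theorem fNorm_coeff_le {p q e : ℕ} (N : Matrix (Fin p) (Fin q) 𝕜[X]) (δ : Fin p → ℕ)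
    (hδ : ∀ i, δ i ≤ e) :
    fNorm (fun i j => (N i j).coeff (δ i) : Matrix (Fin p) (Fin q) 𝕜) ≤ fNorm (sylv e 1 N) := by
  refine le_of_sq_le_sq ?_ (fNorm_nonneg _)
  rw [fNorm_sylv_one_sq]
  refine (fNorm_sq _).trans_le (Finset.sum_le_sum fun i _ => ?_)
  have := hδ i
  exact Finset.single_le_sum (f := fun c => ∑ j, ‖(N i j).coeff c‖ ^ 2)
    (fun c _ => by positivity) (Finset.mem_range.2 (by omega : δ i < 1 + e))

theorem norm_sylv_sub_le {p q e k : ℕ} (M M' : Matrix (Fin p) (Fin q) 𝕜[X])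
    (x : EuclideanSpace 𝕜 (Fin k × Fin q)) :
    ‖Matrix.toEuclideanLin (sylv e k M - sylv e k M') x‖ ≤
      Real.sqrt k * sNorm (sylv e 1 M - sylv e 1 M') * ‖x‖ := by
  rw [← sylv_sub, ← sylv_sub]
  exact norm_sylv_le _ x

theorem InjOnDegLT.of_perturbation {p q e k : ℕ} {M M' : Matrix (Fin p) (Fin q) 𝕜[X]}
    (hM' : ∀ i j, (M' i j).natDegree ≤ e)
    (h : Real.sqrt k * sNorm (sylv e 1 M - sylv e 1 M') < singVal (sylv e k M) (k * q)) :
    InjOnDegLT k M' :=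
  (injOnDegLT_iff hM').2 fun x hx => injective_of_perturbation (by simp)
    (mul_nonneg (Real.sqrt_nonneg _) (sNorm_nonneg _)) (norm_sylv_sub_le M M') h x hx

theorem SurjOnDegLT.of_perturbation {p q e k : ℕ} {M M' : Matrix (Fin p) (Fin q) 𝕜[X]}
    (hM' : ∀ i j, (M' i j).natDegree ≤ e)
    (h : Real.sqrt k * sNorm (sylv e 1 M - sylv e 1 M') <
      singVal (sylv e k M) ((k + e) * p)) : SurjOnDegLT e k M' := by
  refine (surjOnDegLT_iff hM').2 fun y => ?_
  obtain ⟨r, hr1, hr2⟩ := exists_between h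
  have h0 := mul_nonneg (Real.sqrt_nonneg k) (sNorm_nonneg (sylv e 1 M - sylv e 1 M'))
  obtain ⟨x, hx, -⟩ := exists_preimage_of_perturbation (by simp) (h0.trans hr1.le) hr1
    (norm_sylv_sub_le M M') hr2 (WithLp.toLp 2 y)
  exact ⟨x.ofLp, congrArg WithLp.ofLp hx⟩

theorem exists_null_near {p q e k : ℕ} {M M' : Matrix (Fin p) (Fin q) 𝕜[X]}
    (hM : ∀ i j, (M i j).natDegree ≤ e) (hM' : ∀ i j, (M' i j).natDegree ≤ e) {θ : ℝ}
    (hk : 1 ≤ k) (hθ : θ * Real.sqrt k ≤ singVal (sylv e k M) ((k + e) * p))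
    (hε : 2 * sNorm (sylv e 1 M - sylv e 1 M') < θ) {v : Fin q → 𝕜[X]} (hv : VecDegLT k v)
    (hnull : M *ᵥ v = 0) :
    ∃ w, VecDegLT k w ∧ M' *ᵥ w = 0 ∧ coeffNormSq k (v - w) ≤
      (2 / θ * sNorm (sylv e 1 M - sylv e 1 M')) ^ 2 * coeffNormSq k v := by
  set E := sNorm (sylv e 1 M - sylv e 1 M')
  have hE0 : 0 ≤ E := sNorm_nonneg _
  have hθ0 : 0 < θ := by linarith
  have hk0 : 0 < Real.sqrt k := Real.sqrt_pos.2 (by exact_mod_cast hk)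
  set c := WithLp.toLp 2 (coeffVec k v) with hc
  have hlt : Real.sqrt k * E + θ / 2 * Real.sqrt k < singVal (sylv e k M) ((k + e) * p) := by
    nlinarith
  obtain ⟨x, hx, hxn⟩ := exists_preimage_of_perturbation (by simp) (by positivity)
    (lt_add_of_pos_right (Real.sqrt k * E) (by positivity : 0 < θ / 2 * Real.sqrt k))
    (norm_sylv_sub_le M M') hlt (Matrix.toEuclideanLin (sylv e k M') c)
  have hx' : sylv e k M' *ᵥ x.ofLp = sylv e k M' *ᵥ coeffVec k v := congrArg WithLp.ofLp hx
  have hcM : Matrix.toEuclideanLin (sylv e k M) c = 0 := by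
    apply WithLp.ofLp_injective
    rw [toEuclideanLin_ofLp, hc, sylv_mulVec_coeffVec hM hv, hnull]
    ext
    simp [coeffVec]
  have hcn : ‖Matrix.toEuclideanLin (sylv e k M') c‖ ≤ Real.sqrt k * E * ‖c‖ := by
    have := norm_sylv_sub_le (e := e) M M' c
    rwa [map_sub, LinearMap.sub_apply, hcM, zero_sub, norm_neg] at this
  have hxc : ‖x‖ ≤ 2 / θ * E * ‖c‖ := by
    have h1 : θ / 2 * Real.sqrt k * ‖x‖ ≤ Real.sqrt k * E * ‖c‖ := by
      rw [add_sub_cancel_left] at hxn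
      exact hxn.trans hcn
    have h2 : Real.sqrt k * (θ / 2 * ‖x‖) ≤ Real.sqrt k * (E * ‖c‖) := by linarith
    have h3 := le_of_mul_le_mul_left h2 hk0
    rw [show 2 / θ * E * ‖c‖ = 2 * (E * ‖c‖) / θ by ring, le_div_iff₀ hθ0]
    linarith
  refine ⟨v - polyVec x.ofLp, ?_, ?_, ?_⟩
  · rw [sub_eq_add_neg]
    exact hv.add (vecDegLT_polyVec _).neg
  · have h1 : sylv e k M' *ᵥ (coeffVec k v - x.ofLp) = 0 := by
      rw [Matrix.mulVec_sub, hx', sub_self]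
    rw [sylv_mulVec_eq_zero_iff hM'] at h1
    rw [← h1]
    congr 1
    nth_rewrite 1 [← polyVec_coeffVec hv]
    ext j r
    simp only [Pi.sub_apply, coeff_sub, coeff_polyVec]
    split_ifs <;> simp
  · rw [sub_sub_cancel, ← norm_toLp_coeffVec_sq, ← norm_toLp_coeffVec_sq, coeffVec_polyVec,
      ← mul_pow]
    exact pow_le_pow_left₀ (norm_nonneg _) hxc 2

end NormEstimates

section FullSylvesterRank

theorem mul_transpose_eq_zero_iff {m n q : ℕ} {M : Matrix (Fin m) (Fin q) F[X]}
    {N : Matrix (Fin n) (Fin q) F[X]} : M * Nᵀ = 0 ↔ ∀ i, M *ᵥ N i = 0 := by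
  constructor
  · intro h i
    ext1 j
    exact congrFun (congrFun h j) i
  · intro h
    ext1 j i
    exact congrFun (h i) j

theorem eq_zero_of_vecMul_eq_zero_of_surjective {a b : Type*} [Fintype a] [Fintype b]
    {A : Matrix a b F} (hA : ∀ y, ∃ x, A *ᵥ x = y) {z : a → F} (hz : z ᵥ* A = 0) : z = 0 := by
  refine dotProduct_eq_zero_iff.1 fun y => ?_
  obtain ⟨x, rfl⟩ := hA y
  rw [Matrix.dotProduct_mulVec, hz, zero_dotProduct]

variable {m n d k₀ : ℕ} {M : Matrix (Fin m) (Fin (m + n)) F[X]}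

theorem HasFullSylvesterRank.injOnDegLT_pred (h : HasFullSylvesterRank d M)
    (hdeg : ∀ i j, (M i j).natDegree ≤ d) (hk : ∀ k, k₀ ≤ k ↔ m * d ≤ n * k) :
    InjOnDegLT (k₀ - 1) M := by
  rcases Nat.eq_zero_or_pos (k₀ - 1) with h0 | h0
  · intro v hv _
    rw [h0] at hv
    exact vecDegLT_zero_iff.1 hv
  · rw [← rank_sylv_eq_cols_iff hdeg, h _ h0, min_eq_right]
    have := (hk (k₀ - 1)).not.1 (by omega)
    nlinarith

theorem HasFullSylvesterRank.surjOnDegLT (h : HasFullSylvesterRank d M)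
    (hdeg : ∀ i j, (M i j).natDegree ≤ d) (hpos : 1 ≤ k₀)
    (hk : ∀ k, k₀ ≤ k ↔ m * d ≤ n * k) : SurjOnDegLT d k₀ M := by
  rw [← rank_sylv_eq_rows_iff hdeg, h _ hpos, min_eq_left]
  have := (hk k₀).1 le_rfl
  nlinarith

theorem hasFullSylvesterRank_of_injOnDegLT_of_surjOnDegLT
    (hdeg : ∀ i j, (M i j).natDegree ≤ d) (hpos : 1 ≤ k₀)
    (hk : ∀ k, k₀ ≤ k ↔ m * d ≤ n * k) (hinj : InjOnDegLT (k₀ - 1) M)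
    (hsurj : SurjOnDegLT d k₀ M) : HasFullSylvesterRank d M := by
  intro k hk1
  rcases le_or_gt k₀ k with h | h
  · rw [(rank_sylv_eq_rows_iff hdeg).2 (hsurj.mono hpos h), min_eq_left]
    have := (hk k).1 h
    nlinarith
  · rw [(rank_sylv_eq_cols_iff hdeg).2 (hinj.mono (by omega)), min_eq_right]
    have := (hk k).not.1 (by omega)
    nlinarith

end FullSylvesterRank

/-- Perturbations of minimal bases dual to full-Sylvester-rank matrices: if
`‖S_1(M) - S_1(M̃)‖_2 < (1/2)·θ_1(M)·σ_n(N_hr)/‖S_1(N)‖_F` then `M̃` has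
full-Sylvester-rank and has a dual minimal basis `Ñ` with
`‖S_1(N) - S_1(Ñ)‖_F/‖S_1(N)‖_F ≤ (2/θ_2(M))·‖S_1(M) - S_1(M̃)‖_2`; moreover if
`t = 0` all row degrees of `N` and `Ñ` equal `k'`. -/
theorem perturbation_dual_minimal_basis {𝕜 : Type*} [RCLike 𝕜] {m n d : ℕ}
    (hm : 0 < m) (hn : 0 < n) (hd : 0 < d)
    (M : Matrix (Fin m) (Fin (m + n)) 𝕜[X]) (hdeg : ∀ i j, (M i j).natDegree ≤ d)
    (hfull : HasFullSylvesterRank d M)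
    (k' t : ℕ) (hk' : k' = ⌈(m * d : ℚ) / (n : ℚ)⌉₊) (ht : t = n * k' - m * d)
    (N : Matrix (Fin n) (Fin (m + n)) 𝕜[X]) (hNdeg : ∀ i j, (N i j).natDegree ≤ k')
    (hNmb : IsMinimalBasis N) (hdual : M * Nᵀ = 0)
    (θ1 θ2 : ℝ)
    (hθa : 1 < k' → 0 < t →
      θ1 = min (min (singVal (sylv d (k' - 1) M) ((k' - 1) * (m + n)) / Real.sqrt (k' - 1))
                    (singVal (sylv d k' M) ((k' + d) * m) / Real.sqrt k'))
               (singVal (sylv d (k' + 1) M) ((k' + 1 + d) * m) / Real.sqrt (k' + 1)) ∧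
      θ2 = min (singVal (sylv d k' M) ((k' + d) * m) / Real.sqrt k')
               (singVal (sylv d (k' + 1) M) ((k' + 1 + d) * m) / Real.sqrt (k' + 1)))
    (hθb : k' = 1 → 0 < t →
      θ1 = min (singVal (sylv d 1 M) ((d + 1) * m))
               (singVal (sylv d 2 M) ((d + 2) * m) / Real.sqrt 2) ∧
      θ2 = θ1)
    (hθc : t = 0 →
      θ1 = min (singVal (sylv d k' M) ((k' + d) * m) / Real.sqrt k')
               (singVal (sylv d (k' + 1) M) ((k' + 1 + d) * m) / Real.sqrt (k' + 1)) ∧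
      θ2 = singVal (sylv d (k' + 1) M) ((k' + 1 + d) * m) / Real.sqrt (k' + 1)) :
    ∀ M' : Matrix (Fin m) (Fin (m + n)) 𝕜[X], (∀ i j, (M' i j).natDegree ≤ d) →
      sNorm (sylv d 1 M - sylv d 1 M') <
        (1 / 2) * θ1 * (singVal (highRowMat N) n / fNorm (sylv k' 1 N)) →
      HasFullSylvesterRank d M' ∧
      ∃ N' : Matrix (Fin n) (Fin (m + n)) 𝕜[X],
        (∀ i j, (N' i j).natDegree ≤ k') ∧ IsMinimalBasis N' ∧ M' * N'ᵀ = 0 ∧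
        fNorm (sylv k' 1 N - sylv k' 1 N') / fNorm (sylv k' 1 N) ≤
          (2 / θ2) * sNorm (sylv d 1 M - sylv d 1 M') ∧
        (t = 0 → (∀ i, rowDeg N' i = k') ∧ ∀ i, rowDeg N i = k') := by
  intro M' hdeg' hlt
  have hceil : ∀ k, k' ≤ k ↔ m * d ≤ n * k := by
    intro k
    rw [hk', Nat.ceil_le, div_le_iff₀ (by exact_mod_cast hn), mul_comm (k : ℚ)]
    exact_mod_cast Iff.rfl
  have hkn : m * d ≤ n * k' := (hceil k').1 le_rfl
  have hkpos : 1 ≤ k' := by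
    by_contra! h
    have := (hceil 0).1 (by omega)
    have := Nat.mul_pos hm hd
    omega
  have hsqrt : 0 < Real.sqrt k' := Real.sqrt_pos.2 (by exact_mod_cast hkpos)
  have hsqrt1 : 0 < Real.sqrt ((k' + 1 : ℕ) : ℝ) := Real.sqrt_pos.2 (by positivity)
  set E := sNorm (sylv d 1 M - sylv d 1 M')
  have hE0 : 0 ≤ E := sNorm_nonneg _
  obtain ⟨hθ1pred, hθ1, hθ2, hθ2succ, hθ12⟩ :
      (1 < k' → 0 < t → θ1 * Real.sqrt ((k' - 1 : ℕ) : ℝ) ≤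
        singVal (sylv d (k' - 1) M) ((k' - 1) * (m + n))) ∧
      θ1 * Real.sqrt k' ≤ singVal (sylv d k' M) ((k' + d) * m) ∧
      (0 < t → θ2 * Real.sqrt k' ≤ singVal (sylv d k' M) ((k' + d) * m)) ∧
      θ2 * Real.sqrt ((k' + 1 : ℕ) : ℝ) ≤
        singVal (sylv d (k' + 1) M) ((k' + 1 + d) * m) ∧ θ1 ≤ θ2 := by
    rw [← le_div_iff₀ hsqrt, ← le_div_iff₀ hsqrt, ← le_div_iff₀ hsqrt1]
    push_cast
    rcases Nat.eq_zero_or_pos t with ht0 | ht0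
    · obtain ⟨rfl, rfl⟩ := hθc ht0
      exact ⟨fun _ h => by omega, min_le_left _ _, fun h => by omega, le_rfl,
        min_le_right _ _⟩
    · rcases hkpos.eq_or_lt with hk1 | hk1
      · obtain ⟨h1, rfl⟩ := hθb hk1.symm ht0
        subst hk1
        have h2 : θ2 ≤ singVal (sylv d 1 M) ((1 + d) * m) / Real.sqrt (1 : ℕ) := by
          rw [h1, Nat.cast_one, Real.sqrt_one, div_one,
            show (1 + d) * m = (d + 1) * m by ring]
          exact min_le_left _ _
        have h3 : θ2 ≤ singVal (sylv d (1 + 1) M) ((1 + 1 + d) * m) /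
            Real.sqrt (((1 : ℕ) : ℝ) + 1) := by
          rw [h1, Nat.cast_one, one_add_one_eq_two (R := ℝ),
            show (1 + 1 + d) * m = (d + 2) * m by ring]
          exact min_le_right _ _
        exact ⟨fun h => absurd h (lt_irrefl _), h2, fun _ => h2, h3, le_rfl⟩
      · obtain ⟨rfl, rfl⟩ := hθa hk1 ht0
        have hsqrt2 : 0 < Real.sqrt ((k' - 1 : ℕ) : ℝ) :=
          Real.sqrt_pos.2 (by exact_mod_cast (by omega : 0 < k' - 1))
        refine ⟨fun _ _ => ?_, (min_le_left _ _).trans (min_le_right _ _),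
          fun _ => min_le_left _ _, min_le_right _ _,
          le_min ((min_le_left _ _).trans (min_le_right _ _)) (min_le_right _ _)⟩
        rw [← le_div_iff₀ hsqrt2, Nat.cast_sub hkpos, Nat.cast_one]
        exact (min_le_left _ _).trans (min_le_left _ _)
  set σ := singVal (highRowMat N) n
  set φ := fNorm (sylv k' 1 N) with hφ
  have hσ0 : 0 ≤ σ := singVal_nonneg _ _
  have hφ0 : 0 ≤ φ := fNorm_nonneg _
  have hrowN : ∀ i, rowDeg N i ≤ k' := fun i => Finset.sup_le fun j _ => hNdeg i j
  have hσφ : σ ≤ φ := (singVal_le_fNorm _ hn).trans (fNorm_coeff_le N _ hrowN)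
  have hθ1pos : 0 < θ1 := by
    by_contra! h
    have := mul_nonpos_of_nonpos_of_nonneg (by linarith : 1 / 2 * θ1 ≤ 0) (div_nonneg hσ0 hφ0)
    linarith
  have hφpos : 0 < φ := by
    refine hφ0.lt_of_ne fun h => ?_
    rw [← h, div_zero, mul_zero] at hlt
    linarith
  have hθ2pos : 0 < θ2 := hθ1pos.trans_le hθ12
  have hEφ : 2 * E * φ < θ1 * σ := by
    rw [← mul_div_assoc, lt_div_iff₀ hφpos] at hlt
    linarith
  have hEθ : 2 * E < θ1 := by
    have : 2 * E * φ < θ1 * φ := hEφ.trans_le (by gcongr)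
    exact lt_of_mul_lt_mul_right this hφ0
  have hEsqrt : ∀ k : ℕ, 0 < k → Real.sqrt k * E < θ1 * Real.sqrt k := by
    intro k hk
    have : 0 < Real.sqrt k := Real.sqrt_pos.2 (by exact_mod_cast hk)
    nlinarith
  have hinjM := hfull.injOnDegLT_pred hdeg hceil
  have hsurjM := hfull.surjOnDegLT hdeg hkpos hceil
  have hsurjM' : SurjOnDegLT d k' M' :=
    .of_perturbation hdeg' ((hEsqrt k' hkpos).trans_le hθ1)
  have htk : n * k' = m * d + t := by omega
  have hdim : t + (k' + d) * m = k' * (m + n) := by linarith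
  have hrank : ∀ {P : Matrix (Fin m) (Fin (m + n)) 𝕜[X]}, (∀ i j, (P i j).natDegree ≤ d) →
      SurjOnDegLT d k' P → t + (sylv d k' P).rank = k' * (m + n) := by
    intro P hP hs
    rw [(rank_sylv_eq_rows_iff hP).2 hs, hdim]
  have hsq : ∀ {P : Matrix (Fin m) (Fin (m + n)) 𝕜[X]}, (∀ i j, (P i j).natDegree ≤ d) →
      SurjOnDegLT d k' P → t = 0 → InjOnDegLT k' P := by
    intro P hP hs ht0
    rw [← rank_sylv_eq_cols_iff hP]
    have := hrank hP hs
    omega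
  have hinjM' : InjOnDegLT (k' - 1) M' := by
    rcases Nat.eq_zero_or_pos t with ht0 | ht0
    · exact (hsq hdeg' hsurjM' ht0).mono (Nat.sub_le _ _)
    · rcases hkpos.eq_or_lt with hk1 | hk1
      · intro v hv _
        rw [← hk1] at hv
        exact vecDegLT_zero_iff.1 hv
      · exact .of_perturbation hdeg'
          ((hEsqrt (k' - 1) (by omega)).trans_le (hθ1pred hk1 ht0))
  refine ⟨hasFullSylvesterRank_of_injOnDegLT_of_surjOnDegLT hdeg' hkpos hceil hinjM' hsurjM', ?_⟩
  have hNnull : ∀ i, M *ᵥ N i = 0 := mul_transpose_eq_zero_iff.1 hdual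
  have hNli := (linearIndependent_ratRow_iff N).1 hNmb.1
  have hnear : ∀ i, ∃ w, VecDegLT (rowDeg N i + 1) w ∧ M' *ᵥ w = 0 ∧
      coeffNormSq (1 + k') (N i - w) ≤ (2 / θ2 * E) ^ 2 * coeffNormSq (1 + k') (N i) := by
    intro i
    have hle := hrowN i
    have hge := le_rowDeg_of_null hinjM hNli hNnull i
    have hv := vecDegLT_row N i
    have hθ : θ2 * Real.sqrt ((rowDeg N i + 1 : ℕ) : ℝ) ≤
        singVal (sylv d (rowDeg N i + 1) M) ((rowDeg N i + 1 + d) * m) := by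
      rcases hle.eq_or_lt with h | h
      · rw [h]
        exact hθ2succ
      · have h' : rowDeg N i + 1 = k' := by omega
        rw [h']
        apply hθ2
        by_contra! ht0
        have := le_rowDeg_of_null (hsq hdeg hsurjM (by omega)) hNli hNnull i
        omega
    obtain ⟨w, hw, hw0, hwn⟩ := exists_null_near hdeg hdeg' (by omega) hθ
      (hEθ.trans_le hθ12) hv (hNnull i)
    refine ⟨w, hw, hw0, ?_⟩
    have hd : VecDegLT (rowDeg N i + 1) (N i - w) := by
      rw [sub_eq_add_neg]
      exact hv.add hw.neg
    rwa [hd.coeffNormSq_eq (by omega), hv.coeffNormSq_eq (by omega)]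
  obtain ⟨N', hN'⟩ : ∃ N' : Matrix (Fin n) (Fin (m + n)) 𝕜[X], ∀ i,
      VecDegLT (rowDeg N i + 1) (N' i) ∧ M' *ᵥ N' i = 0 ∧
      coeffNormSq (1 + k') (N i - N' i) ≤ (2 / θ2 * E) ^ 2 * coeffNormSq (1 + k') (N i) :=
    ⟨fun i => (hnear i).choose, fun i => (hnear i).choose_spec⟩
  have hN'deg := fun i => (hN' i).1
  have hN'null := fun i => (hN' i).2.1
  have hfro : fNorm (sylv k' 1 N - sylv k' 1 N') ≤
      2 / θ2 * E * φ := by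
    refine le_of_sq_le_sq ?_ (by positivity)
    rw [← sylv_sub, fNorm_sylv_one_sq, mul_pow, hφ, fNorm_sylv_one_sq, Finset.mul_sum]
    exact Finset.sum_le_sum fun i _ => (hN' i).2.2
  have hlead : ∀ a : Fin n → 𝕜, (a ᵥ* fun i j => (N' i j).coeff (rowDeg N i)) = 0 → a = 0 := by
    have hlow : fNorm (sylv k' 1 N - sylv k' 1 N') < σ := by
      refine hfro.trans_lt ?_
      rw [show 2 / θ2 * E * φ = 2 * E * φ / θ2 by ring, div_lt_iff₀ hθ2pos]
      nlinarith
    obtain ⟨r, hr1, hr2⟩ := exists_between hlow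
    let B : Matrix (Fin n) (Fin (m + n)) 𝕜 := fun i j => (N' i j).coeff (rowDeg N i)
    have hB : fNorm (highRowMat N - B) ≤ fNorm (sylv k' 1 N - sylv k' 1 N') := by
      rw [← sylv_sub]
      refine le_of_eq_of_le ?_ (fNorm_coeff_le (N - N') (rowDeg N) hrowN)
      congr 1
      ext i j
      exact (coeff_sub _ _ _).symm
    intro a ha
    refine eq_zero_of_vecMul_eq_zero_of_surjective (fun y => ?_) ha
    obtain ⟨x, hx, -⟩ := exists_preimage_of_perturbation (Fintype.card_fin n)
      ((fNorm_nonneg _).trans hr1.le) hr1 (A := highRowMat N)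
      (B := B) (fun x => (norm_toEuclideanLin_le_fNorm _ x).trans
        (mul_le_mul_of_nonneg_right hB (norm_nonneg _))) hr2 (WithLp.toLp 2 y)
    exact ⟨x.ofLp, congrArg WithLp.ofLp hx⟩
  have hN'li := linearIndependent_of_highCoeff N' (rowDeg N) hN'deg hlead
  have hN'row : ∀ i, rowDeg N' i ≤ rowDeg N i :=
    fun i => (rowDeg_le_iff _ i).2 (hN'deg i)
  have hN'li' := (linearIndependent_ratRow_iff N').2 hN'li
  refine ⟨N', fun i j => ?_, ⟨hN'li', rfl, fun L hL hLspan => ?_⟩,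
    mul_transpose_eq_zero_iff.2 hN'null, ?_, fun ht0 => ⟨fun i => ?_, fun i => ?_⟩⟩
  · exact (Finset.le_sup (f := fun j => (N' i j).natDegree) (Finset.mem_univ j)).trans
      ((hN'row i).trans (hrowN i))
  · have hLnull : ∀ i, M' *ᵥ L i = 0 := by
      intro i
      rw [← ratVec_mem_rightNullSpace, ← rowSpan_eq_rightNullSpace hkpos hsurjM' hN'li' hN'null,
        ← hLspan]
      exact Submodule.subset_span ⟨i, rfl⟩
    have h1 := le_sum_rowDeg_of_null hdeg' hinjM' (hrank hdeg' hsurjM')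
      ((linearIndependent_ratRow_iff L).1 hL) hLnull
    have h2 := sum_rowDeg_le_of_isMinimalBasis hdeg hkpos hinjM hsurjM (hrank hdeg hsurjM) hNmb
      hNnull (fun i => (rowDeg_le_iff N i).1 (hrowN i))
    have h3 := Finset.sum_le_sum fun i (_ : i ∈ Finset.univ) => hN'row i
    omega
  · rwa [div_le_iff₀ hφpos]
  · exact le_antisymm ((hN'row i).trans (hrowN i))
      (le_rowDeg_of_null (hsq hdeg' hsurjM' ht0) hN'li hN'null i)
  · exact le_antisymm (hrowN i) (le_rowDeg_of_null (hsq hdeg hsurjM ht0) hNli hNnull i)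

end
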